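/- Moment rigidity underlying the classification of Markov traces (core of Proposition 9.1): let a, b : ℕ → ℝ be summable sequences with a_i ≥ 0, b_j ≥ 0 for all i, j and ∑'_i a_i + ∑'_j b_j ≤ 1, and let t ∈ ℝ satisfy t^{k−1} = ∑'_i (a_i)^k + (−1)^{k−1} · ∑'_j (b_j)^k for every integer k ≥ 2. Then exactly one of the following holds: (1) t = 0 and a_i = 0, b_j = 0 for all i, j; (2) t > 0, b_j = 0 for all j, and there is a positive integer M with t = 1/M such that the set {i | a_i ≠ 0} has exactly M elements and a_i = 1/M for every i in it; (3) t < 0, a_i = 0 for all i, and there is a positive integer N with t = −1/N such that the set {j | b_j ≠ 0} has exactly N elements and b_j = 1/N for every j in it. -/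

import Mathlib

theorem summable_pow_of_nonneg {ι : Type*} {f : ι → ℝ} (hf : ∀ i, 0 ≤ f i) (hs : Summable f)
    {k : ℕ} (hk : k ≠ 0) : Summable fun i => f i ^ k := by
  obtain ⟨n, rfl⟩ := Nat.exists_eq_succ_of_ne_zero hk
  refine Summable.of_nonneg_of_le (fun i => pow_nonneg (hf i) _) (fun i => ?_)
    (hs.mul_left ((∑' i, f i) ^ n))
  rw [pow_succ]
  exact mul_le_mul_of_nonneg_right
    (pow_le_pow_left₀ (hf i) (hs.le_tsum i fun j _ => hf j) n) (hf i)

theorem hasSum_pow_three_mul_sub_sq {ι : Type*} {f : ι → ℝ} (hf : ∀ i, 0 ≤ f i)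
    (hs : Summable f) (t : ℝ) :
    HasSum (fun i => f i ^ 3 * (f i - t) ^ 2)
      ((∑' i, f i ^ 5) - 2 * t * (∑' i, f i ^ 4) + t ^ 2 * ∑' i, f i ^ 3) := by
  have h {k : ℕ} (hk : k ≠ 0) := (summable_pow_of_nonneg hf hs hk).hasSum
  have hexpand : (fun i => f i ^ 3 * (f i - t) ^ 2) =
      fun i => f i ^ 5 - 2 * t * f i ^ 4 + t ^ 2 * f i ^ 3 := by
    ext i
    ring
  rw [hexpand]
  exact ((h (by simp)).sub ((h (by simp)).mul_left (2 * t))).add ((h (by simp)).mul_left (t ^ 2))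

/-- Integrating `x ^ 2 * (x - t) ^ 2` against the measure `∑ aᵢ δ_{aᵢ} + ∑ bⱼ δ_{-bⱼ}` shows that
it has no atoms other than `0` and `t`. -/
theorem eq_zero_or_eq_of_moments {ι κ : Type*} {a : ι → ℝ} {b : κ → ℝ}
    (ha : ∀ i, 0 ≤ a i) (hb : ∀ j, 0 ≤ b j) (hsa : Summable a) (hsb : Summable b) {t : ℝ}
    (ht : ∀ k : ℕ, 2 ≤ k →
      t ^ (k - 1) = (∑' i, (a i) ^ k) + (-1) ^ (k - 1) * ∑' j, (b j) ^ k) :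
    (∀ i, a i = 0 ∨ a i = t) ∧ ∀ j, b j = 0 ∨ b j = -t := by
  have hA := hasSum_pow_three_mul_sub_sq ha hsa t
  have hB := hasSum_pow_three_mul_sub_sq hb hsb (-t)
  have hA₀ : ∀ i, 0 ≤ a i ^ 3 * (a i - t) ^ 2 := fun i =>
    mul_nonneg (pow_nonneg (ha i) 3) (sq_nonneg _)
  have hB₀ : ∀ j, 0 ≤ b j ^ 3 * (b j - -t) ^ 2 := fun j =>
    mul_nonneg (pow_nonneg (hb j) 3) (sq_nonneg _)
  have h3 := ht 3 (by norm_num)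
  have h4 := ht 4 (by norm_num)
  have h5 := ht 5 (by norm_num)
  norm_num at h3 h4 h5
  have hsum : ((∑' i, a i ^ 5) - 2 * t * (∑' i, a i ^ 4) + t ^ 2 * ∑' i, a i ^ 3) +
      ((∑' j, b j ^ 5) - 2 * -t * (∑' j, b j ^ 4) + (-t) ^ 2 * ∑' j, b j ^ 3) = 0 := by
    linear_combination 2 * t * h4 - h5 - t ^ 2 * h3
  have hA_nonneg := hA.nonneg hA₀
  have hB_nonneg := hB.nonneg hB₀
  rw [(add_eq_zero_iff_of_nonneg hA_nonneg hB_nonneg).1 hsum |>.1,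
    hasSum_zero_iff_of_nonneg hA₀] at hA
  rw [(add_eq_zero_iff_of_nonneg hA_nonneg hB_nonneg).1 hsum |>.2,
    hasSum_zero_iff_of_nonneg hB₀] at hB
  constructor
  · intro i
    simpa [sub_eq_zero] using congrFun hA i
  · intro j
    simpa [add_eq_zero_iff_eq_neg] using congrFun hB j

theorem exists_ncard_support_of_tsum_sq_eq {ι : Type*} {f : ι → ℝ} {t : ℝ} (ht : 0 < t)
    (hs : Summable f) (hf : ∀ i, f i = 0 ∨ f i = t) (hsq : ∑' i, f i ^ 2 = t) :
    ∃ M : ℕ, 0 < M ∧ t = 1 / (M : ℝ) ∧ {i | f i ≠ 0}.ncard = M ∧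
      ∀ i, f i ≠ 0 → f i = 1 / (M : ℝ) := by
  have hfin : {i | f i ≠ 0}.Finite := by
    refine (Filter.eventually_cofinite.1 (hs.tendsto_cofinite_zero.eventually_lt_const ht)).subset
      fun i hi => ?_
    simp [(hf i).resolve_left hi]
  have hcount : ({i | f i ≠ 0}.ncard : ℝ) * t ^ 2 = t := by
    have hsum : ∑ i ∈ hfin.toFinset, f i ^ 2 = ∑ _i ∈ hfin.toFinset, t ^ 2 :=
      Finset.sum_congr rfl fun i hi => by rw [(hf i).resolve_left (by simpa using hi)]
    rw [tsum_eq_sum (s := hfin.toFinset) (by simp), hsum, Finset.sum_const, nsmul_eq_mul,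
      ← Set.ncard_eq_toFinset_card _ hfin] at hsq
    exact hsq
  have hmul : ({i | f i ≠ 0}.ncard : ℝ) * t = 1 := by
    apply mul_right_cancel₀ ht.ne'
    linear_combination hcount
  have hM : 0 < {i | f i ≠ 0}.ncard := by
    refine Nat.pos_of_ne_zero fun h => ?_
    simp [h] at hmul
  have htM : t = 1 / ({i | f i ≠ 0}.ncard : ℝ) := eq_one_div_of_mul_eq_one_right hmul
  exact ⟨_, hM, htM, rfl, fun i hi => ((hf i).resolve_left hi).trans htM⟩


/-- Moment rigidity underlying the classification of Markov traces: if
`t^(k-1) = ∑ aᵢᵏ + (-1)^(k-1) ∑ bⱼᵏ` for all `k ≥ 2`, where `a, b` are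
nonnegative summable sequences with total sum at most `1`, then either
`t = 0` and `a = b = 0`, or `t = 1/M > 0`, `b = 0` and `a` takes the value
`1/M` exactly `M` times (and `0` otherwise), or `t = -1/N < 0`, `a = 0` and
`b` takes the value `1/N` exactly `N` times (and `0` otherwise). -/
theorem moment_rigidity_markov_trace (a b : ℕ → ℝ)
    (ha : ∀ i, 0 ≤ a i) (hb : ∀ j, 0 ≤ b j)
    (hsa : Summable a) (hsb : Summable b)
    (hsum : (∑' i, a i) + (∑' j, b j) ≤ 1)
    (t : ℝ)
    (ht : ∀ k : ℕ, 2 ≤ k →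
      t ^ (k - 1) = (∑' i, (a i) ^ k) + (-1) ^ (k - 1) * ∑' j, (b j) ^ k) :
    (t = 0 ∧ (∀ i, a i = 0) ∧ (∀ j, b j = 0)) ∨
    (0 < t ∧ (∀ j, b j = 0) ∧ ∃ M : ℕ, 0 < M ∧ t = 1 / (M : ℝ) ∧
      {i : ℕ | a i ≠ 0}.ncard = M ∧ ∀ i, a i ≠ 0 → a i = 1 / (M : ℝ)) ∨
    (t < 0 ∧ (∀ i, a i = 0) ∧ ∃ N : ℕ, 0 < N ∧ t = -(1 / (N : ℝ)) ∧
      {j : ℕ | b j ≠ 0}.ncard = N ∧ ∀ j, b j ≠ 0 → b j = 1 / (N : ℝ)) := by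
  obtain ⟨hat, hbt⟩ := eq_zero_or_eq_of_moments ha hb hsa hsb ht
  have h2 := ht 2 le_rfl
  norm_num at h2
  rcases lt_trichotomy t 0 with h | rfl | h
  · have ha0 : ∀ i, a i = 0 := fun i => (hat i).resolve_right fun hi => by linarith [ha i]
    refine .inr (.inr ⟨h, ha0, ?_⟩)
    obtain ⟨N, hN, htN, hcard, hval⟩ := exists_ncard_support_of_tsum_sq_eq (neg_pos.2 h) hsb hbt
      (by simp only [ha0] at h2; norm_num at h2; linarith)
    exact ⟨N, hN, by linarith, hcard, hval⟩
  · exact .inl ⟨rfl, by simpa using hat, by simpa using hbt⟩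
  · have hb0 : ∀ j, b j = 0 := fun j => (hbt j).resolve_right fun hj => by linarith [hb j]
    exact .inr (.inl ⟨h, hb0, exists_ncard_support_of_tsum_sq_eq h hsa hat
      (by simp only [hb0] at h2; norm_num at h2; linarith)⟩)
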